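/- For any complex scalar field φ and any connection 1-form A with curvature F = dA, writing ρ = ½F(L̲, L), the covariant wave operator factorizes under the null frame as r·□_Aφ = −D_L D_{L̲}(rφ) + D̸²(rφ) − iρ·(rφ) = −D_{L̲} D_L(rφ) + D̸²(rφ) + iρ·(rφ), where D̸² = D̸^{e₁}D̸_{e₁} + D̸^{e₂}D̸_{e₂} is the covariant angular Laplacian. -/

import Mathlib

/-!  Common setup: Minkowski space ℝ^{3+1}, null frame, Maxwell–Klein–Gordon objects. -/

noncomputable section

open MeasureTheory ENNReal Set Metric

/-- spacetime points of ℝ^{3+1} -/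
abbrev V : Type := Fin 4 → ℝ
/-- spatial points -/
abbrev E3 : Type := EuclideanSpace ℝ (Fin 3)

namespace MKG

def oR (x : ℝ) : ℝ≥0∞ := ENNReal.ofReal x

/-! ## Coordinates -/
def tC (p : V) : ℝ := p 0
def rad (p : V) : ℝ := Real.sqrt (∑ i : Fin 3, (p i.succ) ^ 2)
def uC (p : V) : ℝ := (tC p - rad p) / 2
def vC (p : V) : ℝ := (tC p + rad p) / 2
def rplus (p : V) : ℝ := 1 + rad p
def uplus (p : V) : ℝ := 1 + |uC p|
def taupl (τ : ℝ) : ℝ := 1 + |τ|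
/-- Minkowski metric diag(-1,1,1,1) (diagonal entries). -/
def eta : Fin 4 → ℝ := fun μ => if μ = 0 then -1 else 1

/-- spacetime point from time and space -/
def stp (t : ℝ) (x : E3) : V := ![t, x 0, x 1, x 2]
/-- spacetime point from time, radius and angle -/
def pt (t r : ℝ) (ω : E3) : V := ![t, r * ω 0, r * ω 1, r * ω 2]

/-! ## Derivatives, connection, curvature -/
def pd (μ : Fin 4) (f : V → ℝ) (p : V) : ℝ := fderiv ℝ f p (Pi.single μ 1)
def pdC (μ : Fin 4) (f : V → ℂ) (p : V) : ℂ := fderiv ℝ f p (Pi.single μ 1)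

/-- covariant derivative D_μ = ∂_μ + i A_μ -/
def covD (A : V → Fin 4 → ℝ) (μ : Fin 4) (φ : V → ℂ) (p : V) : ℂ :=
  pdC μ φ p + Complex.I * (A p μ) * φ p
/-- second covariant derivative D_μ D_ν φ -/
def covD2 (A : V → Fin 4 → ℝ) (μ ν : Fin 4) (φ : V → ℂ) (p : V) : ℂ :=
  pdC μ (covD A ν φ) p + Complex.I * (A p μ) * covD A ν φ p
/-- covariant wave operator □_A = D^μ D_μ -/
def boxA (A : V → Fin 4 → ℝ) (φ : V → ℂ) (p : V) : ℂ :=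
  ∑ μ, (eta μ : ℂ) * covD2 A μ μ φ p
/-- curvature 2-form F = dA -/
def curv (A : V → Fin 4 → ℝ) (p : V) (μ ν : Fin 4) : ℝ :=
  pd μ (fun q => A q ν) p - pd ν (fun q => A q μ) p

/-- (δG)_ν = ∂^μ G_{μν} (divergence over the first index) -/
def divFst (G : V → Fin 4 → Fin 4 → ℝ) (p : V) (ν : Fin 4) : ℝ :=
  ∑ μ, eta μ * pd μ (fun q => G q μ ν) p
/-- J_μ = ∂^ν G_{μν} (divergence over the second index) -/
def divSnd (G : V → Fin 4 → Fin 4 → ℝ) (p : V) (μ : Fin 4) : ℝ :=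
  ∑ ν, eta ν * pd ν (fun q => G q μ ν) p

/-! ## Null frame and null decompositions -/
/-- outgoing null vector L = ∂_t + ∂_r -/
def Lv (p : V) : V := ![1, p 1 / rad p, p 2 / rad p, p 3 / rad p]
/-- incoming null vector L̲ = ∂_t − ∂_r -/
def Lbv (p : V) : V := ![1, -(p 1 / rad p), -(p 2 / rad p), -(p 3 / rad p)]
/-- radial vector ∂_r -/
def rv (p : V) : V := ![0, p 1 / rad p, p 2 / rad p, p 3 / rad p]
/-- tangential projection frame P_j = ∂_j − ω_j ∂_r (spanning the spheres'
tangent space; for any covector ξ one has Σ_j ξ(P_j)² = |ξ restricted to the sphere|²). -/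
def Pv (p : V) (j : Fin 3) : V :=
  fun μ => if μ = 0 then 0 else
    (if μ = j.succ then 1 else 0) - p j.succ * p μ / rad p ^ 2

/-- evaluation of a 2-form on two vectors -/
def ap2 (G : V → Fin 4 → Fin 4 → ℝ) (X Y : V) (p : V) : ℝ := ∑ μ, ∑ ν, X μ * Y ν * G p μ ν
/-- evaluation of a 1-form on a vector -/
def ap1 (J : V → Fin 4 → ℝ) (X : V) (p : V) : ℝ := ∑ μ, X μ * J p μ

/-- |α|² = Σ_i F(L,e_i)² -/
def alphaSq (G : V → Fin 4 → Fin 4 → ℝ) (p : V) : ℝ := ∑ j : Fin 3, (ap2 G (Lv p) (Pv p j) p) ^ 2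
/-- |α̲|² = Σ_i F(L̲,e_i)² -/
def abarSq (G : V → Fin 4 → Fin 4 → ℝ) (p : V) : ℝ := ∑ j : Fin 3, (ap2 G (Lbv p) (Pv p j) p) ^ 2
/-- ρ = ½ F(L̲,L) -/
def rhoC (G : V → Fin 4 → Fin 4 → ℝ) (p : V) : ℝ := (1 / 2) * ap2 G (Lbv p) (Lv p) p
/-- σ² = F(e₁,e₂)² -/
def sigmaSq (G : V → Fin 4 → Fin 4 → ℝ) (p : V) : ℝ :=
  (1 / 2) * ∑ j : Fin 3, ∑ k : Fin 3, (ap2 G (Pv p j) (Pv p k) p) ^ 2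
/-- |F|², the sum of the squares of all (independent) components -/
def fSq (G : V → Fin 4 → Fin 4 → ℝ) (p : V) : ℝ := (1 / 2) * ∑ μ, ∑ ν, (G p μ ν) ^ 2
/-- squared angular part |J̸|² of a 1-form -/
def JslashSq (J : V → Fin 4 → ℝ) (p : V) : ℝ := ∑ j : Fin 3, (ap1 J (Pv p j) p) ^ 2

/-! ## Scalar field: null derivatives and energy densities -/
/-- directional covariant derivative -/
def dirD (A : V → Fin 4 → ℝ) (X : V) (φ : V → ℂ) (p : V) : ℂ :=
  ∑ μ, (X μ : ℂ) * covD A μ φ p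
/-- the weighted field ψ = rφ -/
def psi (φ : V → ℂ) (p : V) : ℂ := (rad p : ℂ) * φ p
def eDL (A : V → Fin 4 → ℝ) (φ : V → ℂ) (p : V) : ℝ := ‖dirD A (Lv p) φ p‖ ^ 2
def eDLb (A : V → Fin 4 → ℝ) (φ : V → ℂ) (p : V) : ℝ := ‖dirD A (Lbv p) φ p‖ ^ 2
/-- |D̸φ|² -/
def eDslash (A : V → Fin 4 → ℝ) (φ : V → ℂ) (p : V) : ℝ :=
  ∑ j : Fin 3, ‖dirD A (Pv p j) φ p‖ ^ 2
/-- |Dφ|² -/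
def eD (A : V → Fin 4 → ℝ) (φ : V → ℂ) (p : V) : ℝ := ∑ μ, ‖covD A μ φ p‖ ^ 2
/-- |D̄φ|² = |Dφ|² + r₊^{-2}|φ|² -/
def eDbar (A : V → Fin 4 → ℝ) (φ : V → ℂ) (p : V) : ℝ := eD A φ p + ‖φ p‖ ^ 2 / rplus p ^ 2
/-- the covariant angular Laplacian D̸² -/
def covLapSph (A : V → Fin 4 → ℝ) (φ : V → ℂ) (p : V) : ℂ :=
  ∑ j : Fin 3, dirD A (Pv p j) (fun q => dirD A (Pv q j) φ q) p

/-- the current J_μ[φ] = Im(φ · conj(D_μ φ)) -/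
def Jsf (A : V → Fin 4 → ℝ) (φ : V → ℂ) (p : V) (μ : Fin 4) : ℝ :=
  (φ p * (starRingEnd ℂ) (covD A μ φ p)).im
/-- X^μ F_{μν} J^ν[φ] -/
def FJcontr (G : V → Fin 4 → Fin 4 → ℝ) (A : V → Fin 4 → ℝ) (φ : V → ℂ)
    (X : V → V) (p : V) : ℝ :=
  ∑ ν, (∑ μ, X p μ * G p μ ν) * (eta ν * Jsf A φ p ν)

/-! ## Integrals over spheres, null hypersurfaces and regions -/
/-- integral over the unit sphere (2-dimensional Hausdorff measure) -/
def sphLInt (f : E3 → ℝ≥0∞) : ℝ≥0∞ := ∫⁻ ω in sphere (0 : E3) 1, f ω ∂ μH[2]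
/-- sphere integral of a density on the sphere of radius r at time t -/
def sphI (f : V → ℝ) (t r : ℝ) : ℝ≥0∞ := sphLInt (fun ω => oR (f (pt t r ω)))
/-- ∫_{H_u ∩ {v ≥ v₀}} f dv dω -/
def lIntH (u v0 : ℝ) (f : V → ℝ) : ℝ≥0∞ := ∫⁻ v in Ici v0, sphI f (u + v) (v - u)
/-- ∫_{H_u ∩ {v₀ ≤ v ≤ v₁}} f dv dω -/
def lIntHseg (u v0 v1 : ℝ) (f : V → ℝ) : ℝ≥0∞ := ∫⁻ v in Icc v0 v1, sphI f (u + v) (v - u)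
/-- ∫_{H̲_v ∩ {u₀ ≤ u ≤ u₁}} f du dω -/
def lIntHb (v u0 u1 : ℝ) (f : V → ℝ) : ℝ≥0∞ := ∫⁻ u in Icc u0 u1, sphI f (u + v) (v - u)
/-- integral over the ball {|x| ≤ R'} at time t -/
def lIntBall (t R' : ℝ) (f : V → ℝ) : ℝ≥0∞ := ∫⁻ x in closedBall (0 : E3) R', oR (f (stp t x))
/-- integral over the annulus {r₀ ≤ |x| ≤ r₁} at time t -/
def lIntAnn (t r0 r1 : ℝ) (f : V → ℝ) : ℝ≥0∞ :=
  ∫⁻ x in {x : E3 | r0 ≤ ‖x‖ ∧ ‖x‖ ≤ r1}, oR (f (stp t x))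
/-- integral over {|x| ≥ r₀} at time t -/
def lIntExt (t r0 : ℝ) (f : V → ℝ) : ℝ≥0∞ := ∫⁻ x in {x : E3 | r0 ≤ ‖x‖}, oR (f (stp t x))
/-- integral over all of ℝ³ -/
def lIntE3 (f : E3 → ℝ) : ℝ≥0∞ := ∫⁻ x, oR (f x)

/-! ## The foliation Σ_τ and the regions -/
/-- the foliation parameter through a point: t in the cylinder {r ≤ R}, 2u+R outside -/
def sigP (R : ℝ) (p : V) : ℝ := if rad p ≤ R then tC p else 2 * uC p + R
def SigmaSet (R τ : ℝ) : Set V := {p | 0 ≤ tC p ∧ sigP R p = τ}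
/-- interior region 𝒟_{τ₁}^{τ₂} between Σ_{τ₁} and Σ_{τ₂} -/
def Dint (R τ₁ τ₂ : ℝ) : Set V := {p | 0 ≤ tC p ∧ τ₁ ≤ sigP R p ∧ sigP R p ≤ τ₂}
/-- 𝒟̄_{τ₁}^{τ₂} = 𝒟_{τ₁}^{τ₂} ∩ {r ≥ R} -/
def DbarInt (R τ₁ τ₂ : ℝ) : Set V := Dint R τ₁ τ₂ ∩ {p | R ≤ rad p}
/-- exterior region 𝒟_{τ₁}^{τ₂} (τ₂ ≤ τ₁ ≤ 0), the Cauchy development of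
the annulus {R−τ₁ ≤ |x| ≤ R−τ₂} -/
def Dext (R τ₁ τ₂ : ℝ) : Set V :=
  {p | 0 ≤ tC p ∧ uC p ≤ (τ₁ - R) / 2 ∧ vC p ≤ -((τ₂ - R) / 2)}
/-- 𝒟_τ : future of Σ_τ (τ ≥ 0), resp. 𝒟_τ^{-∞} (τ < 0) -/
def Dfrom (R τ : ℝ) : Set V :=
  if 0 ≤ τ then {p | 0 ≤ tC p ∧ τ ≤ sigP R p} else {p | 0 ≤ tC p ∧ uC p ≤ (τ - R) / 2}
def DbarFrom (R τ : ℝ) : Set V := Dfrom R τ ∩ {p | R ≤ rad p}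
def halfSpace : Set V := {p | 0 ≤ tC p}
def regGe (R : ℝ) : Set V := {p | 0 ≤ tC p ∧ R ≤ rad p}
def regLe (R' : ℝ) : Set V := {p | 0 ≤ tC p ∧ rad p ≤ R'}

/-- weighted spacetime norm  I^{pw}_{qw}[·](D) = ∫_D u₊^{qw} r₊^{pw} g  (g = squared magnitude) -/
def wI (pw qw : ℝ) (g : V → ℝ) (D : Set V) : ℝ≥0∞ :=
  ∫⁻ x in D, oR (uplus x ^ qw * rplus x ^ pw * g x)

/-- surface integral over Σ_τ with the measures dx (ball part) and r²dv dω (null part) -/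
def lIntSigE (R τ : ℝ) (f : V → ℝ) : ℝ≥0∞ :=
  if 0 ≤ τ then lIntBall τ R f + lIntH ((τ - R) / 2) ((τ + R) / 2) (fun p => f p * rad p ^ 2)
  else lIntH ((τ - R) / 2) (-((τ - R) / 2)) (fun p => f p * rad p ^ 2)
/-- integral over Σ_τ with the measure dv′dω (v′ = v on the null part, r in the cylinder) -/
def lIntSig (R τ : ℝ) (f : V → ℝ) : ℝ≥0∞ :=
  if 0 ≤ τ then (∫⁻ r' in Icc (0 : ℝ) R, sphI f τ r') + lIntH ((τ - R) / 2) ((τ + R) / 2) f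
  else lIntH ((τ - R) / 2) (-((τ - R) / 2)) f

/-- the starting value v(u) of H_u (t = 0 in the exterior, r = R in the interior) -/
def vStart (R u : ℝ) : ℝ := if u ≤ -R / 2 then -u else 2 * R + u

/-- exterior region in (u,v,ω) coordinates: double null integral ∬_{𝒟_{τ₁}^{τ₂}} f dv dω du -/
def lIntExtUV (R τ₁ τ₂ : ℝ) (f : V → ℝ) : ℝ≥0∞ :=
  ∫⁻ u in Icc ((τ₂ - R) / 2) ((τ₁ - R) / 2),
    ∫⁻ v in Icc (-u) (-((τ₂ - R) / 2)), sphI f (u + v) (v - u)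

/-! ## Energy fluxes -/
def EphiH (A : V → Fin 4 → ℝ) (φ : V → ℂ) (u v0 : ℝ) : ℝ≥0∞ :=
  lIntH u v0 (fun p => (eDL A φ p + eDslash A φ p) * rad p ^ 2)
def EphiHseg (A : V → Fin 4 → ℝ) (φ : V → ℂ) (u v0 v1 : ℝ) : ℝ≥0∞ :=
  lIntHseg u v0 v1 (fun p => (eDL A φ p + eDslash A φ p) * rad p ^ 2)
def EphiHb (A : V → Fin 4 → ℝ) (φ : V → ℂ) (v u0 u1 : ℝ) : ℝ≥0∞ :=
  lIntHb v u0 u1 (fun p => (eDLb A φ p + eDslash A φ p) * rad p ^ 2)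
/-- energy flux E[φ](Σ_τ) -/
def EphiSig (R : ℝ) (A : V → Fin 4 → ℝ) (φ : V → ℂ) (τ : ℝ) : ℝ≥0∞ :=
  if 0 ≤ τ then lIntBall τ R (eD A φ) + EphiH A φ ((τ - R) / 2) ((τ + R) / 2)
  else EphiH A φ ((τ - R) / 2) (-((τ - R) / 2))

def EfH (G : V → Fin 4 → Fin 4 → ℝ) (u v0 : ℝ) : ℝ≥0∞ :=
  lIntH u v0 (fun p => (rhoC G p ^ 2 + sigmaSq G p + alphaSq G p) * rad p ^ 2)
def EfHseg (G : V → Fin 4 → Fin 4 → ℝ) (u v0 v1 : ℝ) : ℝ≥0∞ :=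
  lIntHseg u v0 v1 (fun p => (rhoC G p ^ 2 + sigmaSq G p + alphaSq G p) * rad p ^ 2)
def EfHb (G : V → Fin 4 → Fin 4 → ℝ) (v u0 u1 : ℝ) : ℝ≥0∞ :=
  lIntHb v u0 u1 (fun p => (rhoC G p ^ 2 + sigmaSq G p + abarSq G p) * rad p ^ 2)
/-- energy flux E[G](Σ_τ) of a 2-form -/
def EfSig (R : ℝ) (G : V → Fin 4 → Fin 4 → ℝ) (τ : ℝ) : ℝ≥0∞ :=
  if 0 ≤ τ then
    lIntBall τ R (fun p => rhoC G p ^ 2 + sigmaSq G p + (1 / 2) * (alphaSq G p + abarSq G p))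
      + EfH G ((τ - R) / 2) ((τ + R) / 2)
  else EfH G ((τ - R) / 2) (-((τ - R) / 2))

/-! ## The commutation vector fields Z = {∂_t, Ω_ij} and Lie derivatives -/
inductive Gen : Type
  | time : Gen
  | rot : Fin 3 → Fin 3 → Gen
  deriving DecidableEq

instance : Fintype Gen := by
  classical
  exact Fintype.ofSurjective
    (fun x : Option (Fin 3 × Fin 3) => (x.casesOn Gen.time (fun ij => Gen.rot ij.1 ij.2) : Gen))
    (by rintro (_ | ⟨i, j⟩); exacts [⟨none, rfl⟩, ⟨some (i, j), rfl⟩])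

/-- the vector field of a generator: ∂_t, resp. Ω_ij = x_i ∂_j − x_j ∂_i -/
def genV : Gen → V → V
  | Gen.time, _ => Pi.single 0 1
  | Gen.rot i j, p => fun μ => (if μ = j.succ then p i.succ else 0) - (if μ = i.succ then p j.succ else 0)

/-- Lie derivative of a 2-form along X -/
def lie2 (X : V → V) (G : V → Fin 4 → Fin 4 → ℝ) (p : V) (μ ν : Fin 4) : ℝ :=
  fderiv ℝ (fun q => G q μ ν) p (X p)
    + ∑ lam, pd μ (fun q => X q lam) p * G p lam ν
    + ∑ lam, pd ν (fun q => X q lam) p * G p μ lam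
/-- Lie derivative of a 1-form along X -/
def lie1 (X : V → V) (J : V → Fin 4 → ℝ) (p : V) (μ : Fin 4) : ℝ :=
  fderiv ℝ (fun q => J q μ) p (X p) + ∑ lam, pd μ (fun q => X q lam) p * J p lam

def lie2Iter : List Gen → (V → Fin 4 → Fin 4 → ℝ) → V → Fin 4 → Fin 4 → ℝ
  | [], G => G
  | g :: w, G => lie2 (genV g) (lie2Iter w G)
def lie1Iter : List Gen → (V → Fin 4 → ℝ) → V → Fin 4 → ℝ
  | [], J => J
  | g :: w, J => lie1 (genV g) (lie1Iter w J)

/-- covariant derivative D_Z along a generator -/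
def covDZ (A : V → Fin 4 → ℝ) (g : Gen) (φ : V → ℂ) (p : V) : ℂ := dirD A (genV g p) φ p
def covDZIter (A : V → Fin 4 → ℝ) : List Gen → (V → ℂ) → V → ℂ
  | [], φ => φ
  | g :: w, φ => covDZ A g (covDZIter A w φ)

/-! ## Charge and the chargeless part -/
def esingle (j : Fin 3) : E3 := EuclideanSpace.single j 1
/-- total charge q₀ = (1/4π) ∫ div E dx computed at t = 0 -/
def charge (G : V → Fin 4 → Fin 4 → ℝ) : ℝ :=
  (1 / (4 * Real.pi)) *
    ∫ x : E3, ∑ i : Fin 3, fderiv ℝ (fun y => G (stp 0 y) 0 i.succ) x (esingle i)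
/-- the 2-form dt ∧ dr -/
def dtdr (p : V) (μ ν : Fin 4) : ℝ :=
  (if μ = 0 then 1 else 0) * (if ν = 0 then 0 else p ν / rad p)
    - (if ν = 0 then 1 else 0) * (if μ = 0 then 0 else p μ / rad p)
/-- the chargeless part F̄ = F − χ_{{r ≥ t+R}} q₀ r^{-2} dt∧dr -/
def Fbar (R q0 : ℝ) (G : V → Fin 4 → Fin 4 → ℝ) (p : V) (μ ν : Fin 4) : ℝ :=
  G p μ ν - (if tC p + R ≤ rad p then q0 / rad p ^ 2 else 0) * dtdr p μ ν

/-! ## The norms m_k, E₀^k, M_k of the Maxwell data and current -/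
def twoSqAll (G : V → Fin 4 → Fin 4 → ℝ) (p : V) : ℝ := ∑ μ, ∑ ν, (G p μ ν) ^ 2
/-- |∇J|² (spatial gradient of a 1-form) -/
def grad3Sq1 (J : V → Fin 4 → ℝ) (p : V) : ℝ :=
  ∑ i : Fin 3, ∑ μ, (pd i.succ (fun q => J q μ) p) ^ 2
def JdensL (J : V → Fin 4 → ℝ) (p : V) : ℝ := (ap1 J (Lv p) p) ^ 2
def JdensLb (J : V → Fin 4 → ℝ) (p : V) : ℝ := (ap1 J (Lbv p) p) ^ 2
def JdensMix (J : V → Fin 4 → ℝ) (p : V) : ℝ :=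
  (Real.sqrt (JslashSq J p) + |ap1 J (Lv p) p|) ^ 2

/-- the quantity m_k measuring the current J -/
def mFn (R γ₀ ε : ℝ) (J : V → Fin 4 → ℝ) (q0 : ℝ) (k : ℕ) : ℝ≥0∞ :=
  (∑ l ∈ Finset.range (k + 1), ∑ w : Fin l → Gen,
      (wI (1 + γ₀) (1 + ε) (JslashSq (lie1Iter (List.ofFn w) J)) (regGe R)
        + wI (2 + γ₀) 0 (JdensL (lie1Iter (List.ofFn w) J)) (regGe R)
        + wI (1 + ε) (1 + γ₀) (JdensMix (lie1Iter (List.ofFn w) J)) halfSpace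
        + wI (1 - ε) (1 + γ₀ + 2 * ε) (JdensLb (lie1Iter (List.ofFn w) J)) halfSpace))
  + (∑ l ∈ Finset.range k, ∑ w : Fin l → Gen,
      wI 0 (1 + γ₀) (grad3Sq1 (lie1Iter (List.ofFn w) J)) (regLe (2 * R)))
  + oR |q0| * ⨆ (τ : ℝ) (_ : τ ≤ 0), oR (taupl τ ^ (1 + γ₀)) *
      ∫⁻ p in Dfrom R τ, oR (|ap1 J (Lbv p) p| / rad p ^ 2)

/-- weighted initial energy E₀^k[G] of a 2-form -/
def E0F (γ₀ : ℝ) (G : V → Fin 4 → Fin 4 → ℝ) (k : ℕ) : ℝ≥0∞ :=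
  ∑ l ∈ Finset.range (k + 1), ∑ w : Fin l → Gen,
    lIntE3 (fun x => (1 + ‖x‖) ^ (1 + γ₀) * twoSqAll (lie2Iter (List.ofFn w) G) (stp 0 x))

/-- M_k = m_k + E₀^k[F̄] + 1 + |q₀| for the Maxwell field G with current δG -/
def MFn (R γ₀ ε : ℝ) (G : V → Fin 4 → Fin 4 → ℝ) (k : ℕ) : ℝ≥0∞ :=
  mFn R γ₀ ε (fun p μ => divSnd G p μ) (charge G) k
    + E0F γ₀ (Fbar R (charge G) G) k + 1 + oR |charge G|

/-! ## The norms E₀^k[φ], 𝓔_k[φ] of the scalar field -/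
def E0phi (γ₀ : ℝ) (A : V → Fin 4 → ℝ) (φ : V → ℂ) (k : ℕ) : ℝ≥0∞ :=
  ∑ l ∈ Finset.range (k + 1), ∑ w : Fin l → Gen, ∑ j : Fin 3,
    lIntE3 (fun x =>
      (1 + ‖x‖) ^ (1 + γ₀) * ‖covDZIter A (List.ofFn w) (covD A j.succ φ) (stp 0 x)‖ ^ 2)

def calE (γ₀ ε : ℝ) (A : V → Fin 4 → ℝ) (φ : V → ℂ) (k : ℕ) : ℝ≥0∞ :=
  E0phi γ₀ A φ k
    + ∑ l ∈ Finset.range (k + 1), ∑ w : Fin l → Gen,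
        (wI (1 + γ₀) (1 + ε) (fun p => ‖covDZIter A (List.ofFn w) (boxA A φ) p‖ ^ 2) halfSpace
          + wI (1 + ε) (1 + γ₀) (fun p => ‖covDZIter A (List.ofFn w) (boxA A φ) p‖ ^ 2) halfSpace)

/-! ## Mixed L_u²L_v^∞L_ω² and L_v²L_u^∞L_ω² norms on 𝒟̄_τ -/
def mixULV (R τ : ℝ) (f : V → ℝ) : ℝ≥0∞ :=
  if 0 ≤ τ then
    ∫⁻ u in Ici ((τ - R) / 2), ⨆ v ∈ Ici (u + R), sphI (fun p => f p ^ 2) (u + v) (v - u)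
  else
    ∫⁻ u in Iic ((τ - R) / 2), ⨆ v ∈ Ici (-u), sphI (fun p => f p ^ 2) (u + v) (v - u)
def mixVLU (R τ : ℝ) (f : V → ℝ) : ℝ≥0∞ :=
  if 0 ≤ τ then
    ∫⁻ v in Ici ((τ + R) / 2),
      ⨆ u ∈ Icc ((τ - R) / 2) (v - R), sphI (fun p => f p ^ 2) (u + v) (v - u)
  else
    ∫⁻ v in Ici (-((τ - R) / 2)),
      ⨆ u ∈ Icc (-v) ((τ - R) / 2), sphI (fun p => f p ^ 2) (u + v) (v - u)

/-! ## Asymptotic vanishing conditions -/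
def vanishNullInf (φ : V → ℂ) : Prop :=
  ∀ u : ℝ, ∀ ω : E3, ‖ω‖ = 1 →
    Filter.Tendsto (fun v => φ (pt (u + v) (v - u) ω)) Filter.atTop (nhds 0)
def vanishSpatialInf (φ : V → ℂ) : Prop :=
  ∀ ω : E3, ‖ω‖ = 1 → Filter.Tendsto (fun r => φ (pt 0 r ω)) Filter.atTop (nhds 0)

/-! ## Structural properties -/
def AntiSym (G : V → Fin 4 → Fin 4 → ℝ) : Prop := ∀ p μ ν, G p μ ν = -G p ν μ
def Bianchi (G : V → Fin 4 → Fin 4 → ℝ) : Prop :=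
  ∀ (p : V) (γ' μ ν : Fin 4),
    pd γ' (fun q => G q μ ν) p + pd μ (fun q => G q ν γ') p + pd ν (fun q => G q γ' μ) p = 0
def Smooth2Form (G : V → Fin 4 → Fin 4 → ℝ) : Prop := ∀ μ ν, ContDiff ℝ (⊤ : ℕ∞) (fun p => G p μ ν)

/-! ## Initial data (for the Cauchy problem) -/
def pd3 (j : Fin 3) (f : E3 → ℝ) (x : E3) : ℝ := fderiv ℝ f x (esingle j)
def pd3C (j : Fin 3) (f : E3 → ℂ) (x : E3) : ℂ := fderiv ℝ f x (esingle j)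
/-- rotation Ω_ij acting on a scalar -/
def rotSc (i j : Fin 3) (f : E3 → ℝ) (x : E3) : ℝ := x i * pd3 j f x - x j * pd3 i f x
def rotScC (i j : Fin 3) (f : E3 → ℂ) (x : E3) : ℂ :=
  (x i : ℂ) * pd3C j f x - (x j : ℂ) * pd3C i f x
/-- rotation Ω_ij acting on a vector field (Lie derivative) -/
def rotVF (i j : Fin 3) (W : E3 → Fin 3 → ℝ) (x : E3) (k : Fin 3) : ℝ :=
  rotSc i j (fun y => W y k) x - ((if k = j then W x i else 0) - (if k = i then W x j else 0))

abbrev Gen3 : Type := Fin 3 × Fin 3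

def rotScIter : List Gen3 → (E3 → ℝ) → E3 → ℝ
  | [], f => f
  | g :: w, f => rotSc g.1 g.2 (rotScIter w f)
def rotScCIter : List Gen3 → (E3 → ℂ) → E3 → ℂ
  | [], f => f
  | g :: w, f => rotScC g.1 g.2 (rotScCIter w f)
def rotVFIter : List Gen3 → (E3 → Fin 3 → ℝ) → E3 → Fin 3 → ℝ
  | [], W => W
  | g :: w, W => rotVF g.1 g.2 (rotVFIter w W)
def pd3Iter : List (Fin 3) → (E3 → ℝ) → E3 → ℝ
  | [], f => f
  | j :: w, f => pd3 j (pd3Iter w f)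
def pd3CIter : List (Fin 3) → (E3 → ℂ) → E3 → ℂ
  | [], f => f
  | j :: w, f => pd3C j (pd3CIter w f)
def pd3VFIter (w : List (Fin 3)) (W : E3 → Fin 3 → ℝ) (x : E3) (k : Fin 3) : ℝ :=
  pd3Iter w (fun y => W y k) x

/-- the weighted Sobolev norm 𝓜 of the Maxwell initial data (E^{df}, H) -/
def calM (γ₀ : ℝ) (Edf Hd : E3 → Fin 3 → ℝ) : ℝ≥0∞ :=
  ∑ l ∈ Finset.range 3,
    ((∑ w : Fin l → Gen3, lIntE3 (fun x => (1 + ‖x‖) ^ (1 + γ₀) *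
        ((∑ k : Fin 3, (rotVFIter (List.ofFn w) Edf x k) ^ 2)
          + ∑ k : Fin 3, (rotVFIter (List.ofFn w) Hd x k) ^ 2)))
      + ∑ w : Fin l → Fin 3, lIntE3 (fun x => (1 + ‖x‖) ^ (1 + γ₀) *
        ((∑ k : Fin 3, (pd3VFIter (List.ofFn w) Edf x k) ^ 2)
          + ∑ k : Fin 3, (pd3VFIter (List.ofFn w) Hd x k) ^ 2)))

/-- the weighted Sobolev norm 𝓔 of the scalar initial data (φ₀, φ₁) -/
def calEdata (γ₀ : ℝ) (φ₀ φ₁ : E3 → ℂ) : ℝ≥0∞ :=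
  ∑ l ∈ Finset.range 3,
    ((∑ w : Fin l → Gen3, lIntE3 (fun x => (1 + ‖x‖) ^ (1 + γ₀) *
        ((∑ j : Fin 3, ‖pd3C j (rotScCIter (List.ofFn w) φ₀) x‖ ^ 2)
          + ‖rotScCIter (List.ofFn w) φ₁ x‖ ^ 2)))
      + (∑ w : Fin (l + 1) → Fin 3,
          lIntE3 (fun x => (1 + ‖x‖) ^ (1 + γ₀) * ‖pd3CIter (List.ofFn w) φ₀ x‖ ^ 2))
      + (∑ w : Fin l → Fin 3,
          lIntE3 (fun x => (1 + ‖x‖) ^ (1 + γ₀) * ‖pd3CIter (List.ofFn w) φ₁ x‖ ^ 2))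
      + lIntE3 (fun x => (1 + ‖x‖) ^ (1 + γ₀) * ‖φ₀ x‖ ^ 2))

/-- the Maxwell–Klein–Gordon equations (for t ≥ 0) -/
def IsMKG (A : V → Fin 4 → ℝ) (φ : V → ℂ) : Prop :=
  ∀ p : V, 0 ≤ tC p →
    (∀ μ, divSnd (curv A) p μ = Jsf A φ p μ) ∧ boxA A φ p = 0

/-- the solution attains the initial data (E, H, φ₀, φ₁) -/
def InitData (A : V → Fin 4 → ℝ) (φ : V → ℂ) (Ed Hd : E3 → Fin 3 → ℝ)
    (φ₀ φ₁ : E3 → ℂ) : Prop :=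
  (∀ (x : E3) (i : Fin 3), curv A (stp 0 x) 0 i.succ = Ed x i)
    ∧ (∀ x : E3, curv A (stp 0 x) 2 3 = Hd x 0 ∧ curv A (stp 0 x) 3 1 = Hd x 1
        ∧ curv A (stp 0 x) 1 2 = Hd x 2)
    ∧ (∀ x : E3, φ (stp 0 x) = φ₀ x) ∧ (∀ x : E3, covD A 0 φ (stp 0 x) = φ₁ x)

/-- the compatibility (constraint) conditions -/
def Admissible (Ed Hd : E3 → Fin 3 → ℝ) (φ₀ φ₁ : E3 → ℂ) : Prop :=
  (∀ x : E3, (∑ i : Fin 3, pd3 i (fun y => Ed y i) x) = (φ₀ x * (starRingEnd ℂ) (φ₁ x)).im)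
    ∧ (∀ x : E3, (∑ i : Fin 3, pd3 i (fun y => Hd y i) x) = 0)

end MKG

namespace MKG

open Filter Topology

lemma rv_zero (p : V) : rv p 0 = 0 := rfl

lemma rv_succ (p : V) (i : Fin 3) : rv p i.succ = p i.succ / rad p := by
  fin_cases i <;> rfl

lemma Lv_eq (p : V) (μ : Fin 4) : Lv p μ = (if μ = 0 then 1 else 0) + rv p μ := by
  fin_cases μ <;> simp [Lv, rv]

lemma Lbv_eq (p : V) (μ : Fin 4) : Lbv p μ = (if μ = 0 then 1 else 0) - rv p μ := by
  fin_cases μ <;> simp [Lbv, rv]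

lemma Pv_eq (p : V) (j : Fin 3) (μ : Fin 4) :
    Pv p j μ = (if μ = j.succ then 1 else 0) - rv p j.succ * rv p μ := by
  refine Fin.cases ?_ (fun k => ?_) μ
  · simp [Pv, rv_zero, (Fin.succ_ne_zero j).symm]
  · simp only [Pv, Fin.succ_ne_zero, if_false, rv_succ]
    ring

lemma sum_rv_sq {p : V} (hr : 0 < rad p) : rv p 1 ^ 2 + rv p 2 ^ 2 + rv p 3 ^ 2 = 1 := by
  have h : rad p ^ 2 = p 1 ^ 2 + p 2 ^ 2 + p 3 ^ 2 := by
    rw [rad, Real.sq_sqrt (Finset.sum_nonneg fun i _ => sq_nonneg _), Fin.sum_univ_three]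
    rfl
  have h1 : rv p 1 = p 1 / rad p := rfl
  have h2 : rv p 2 = p 2 / rad p := rfl
  have h3 : rv p 3 = p 3 / rad p := rfl
  rw [h1, h2, h3]
  field_simp
  linarith

/-! ### Derivatives of the radius and of the radial vector field -/

lemma contDiffAt_rad {p : V} (hr : 0 < rad p) {n : WithTop ℕ∞} : ContDiffAt ℝ n rad p := by
  unfold rad
  refine ContDiffAt.sqrt (by fun_prop) ?_
  exact (Real.sqrt_pos.1 hr).ne'

lemma continuous_rad : Continuous rad := by
  unfold rad
  fun_prop

lemma eventually_rad_pos {p : V} (hr : 0 < rad p) : ∀ᶠ q in 𝓝 p, 0 < rad q :=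
  continuous_rad.continuousAt.eventually (lt_mem_nhds hr)

lemma pd_coord (μ ν : Fin 4) (p : V) : pd μ (fun q => q ν) p = if μ = ν then 1 else 0 := by
  have h : HasFDerivAt (fun q : V => q ν) (ContinuousLinearMap.proj (R := ℝ) ν) p :=
    (ContinuousLinearMap.proj (R := ℝ) (φ := fun _ : Fin 4 => ℝ) ν).hasFDerivAt
  rw [pd, h.fderiv]
  simp [Pi.single_apply, eq_comm]

lemma pd_mul (μ : Fin 4) {f g : V → ℝ} {p : V} (hf : DifferentiableAt ℝ f p)
    (hg : DifferentiableAt ℝ g p) :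
    pd μ (fun q => f q * g q) p = pd μ f p * g p + f p * pd μ g p := by
  simp only [pd]
  rw [fderiv_fun_mul hf hg]
  simp
  ring

lemma pd_rad (μ : Fin 4) {p : V} (hr : 0 < rad p) : pd μ rad p = rv p μ := by
  have hd : DifferentiableAt ℝ rad p := (contDiffAt_rad hr (n := 1)).differentiableAt (by simp)
  have hsq : (fun q => rad q * rad q) = fun q : V => ∑ i : Fin 3, q i.succ * q i.succ := by
    funext q
    rw [rad, Real.mul_self_sqrt (Finset.sum_nonneg fun i _ => sq_nonneg _)]
    simp only [sq]
  have h1 := pd_mul μ hd hd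
  have h2 : pd μ (fun q : V => ∑ i : Fin 3, q i.succ * q i.succ) p
      = ∑ i : Fin 3, pd μ (fun q : V => q i.succ * q i.succ) p := by
    simp only [pd]
    rw [fderiv_fun_sum (fun i _ => by fun_prop)]
    simp
  have h3 : ∀ i : Fin 3, pd μ (fun q : V => q i.succ * q i.succ) p
      = 2 * (p i.succ * if μ = i.succ then 1 else 0) := fun i => by
    rw [pd_mul μ (by fun_prop) (by fun_prop), pd_coord]
    ring
  rw [hsq, h2, Finset.sum_congr rfl fun i _ => h3 i] at h1
  refine mul_left_cancel₀ (mul_pos two_pos hr).ne' ?_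
  revert h1
  refine Fin.cases ?_ (fun k => ?_) μ <;> intro h1
  · simp [(Fin.succ_ne_zero _).symm] at h1
    rw [rv_zero]
    linarith
  · simp at h1
    rw [rv_succ]
    field_simp
    linarith

lemma contDiffAt_rv (ν : Fin 4) {p : V} (hr : 0 < rad p) {n : WithTop ℕ∞} :
    ContDiffAt ℝ n (fun q => rv q ν) p := by
  refine Fin.cases ?_ (fun k => ?_) ν
  · simpa only [rv_zero] using contDiffAt_const
  · simp only [rv_succ]
    exact ContDiffAt.div (by fun_prop) (contDiffAt_rad hr) hr.ne'

lemma differentiableAt_rv (ν : Fin 4) {p : V} (hr : 0 < rad p) :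
    DifferentiableAt ℝ (fun q => rv q ν) p :=
  (contDiffAt_rv ν hr (n := 1)).differentiableAt (by simp)

lemma pd_rv (μ ν : Fin 4) {p : V} (hr : 0 < rad p) :
    pd μ (fun q => rv q ν) p
      = ((if μ = ν ∧ ν ≠ 0 then 1 else 0) - rv p μ * rv p ν) * (rad p)⁻¹ := by
  refine Fin.cases ?_ (fun k => ?_) ν
  · simp [pd, rv_zero]
  · have hd : DifferentiableAt ℝ rad p := (contDiffAt_rad hr (n := 1)).differentiableAt (by simp)
    have h := pd_mul μ (differentiableAt_rv k.succ hr) hd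
    have he : (fun q => rv q k.succ * rad q) =ᶠ[𝓝 p] fun q => q k.succ := by
      filter_upwards [eventually_rad_pos hr] with q hq
      rw [rv_succ, div_mul_cancel₀ _ hq.ne']
    have h2 : pd μ (fun q => rv q k.succ * rad q) p = if μ = k.succ then 1 else 0 := by
      rw [← pd_coord, pd, pd, he.fderiv_eq]
    rw [h2, pd_rad μ hr] at h
    simp only [ne_eq, Fin.succ_ne_zero, not_false_eq_true, and_true]
    field_simp
    linarith

lemma pd_Lv (μ ν : Fin 4) (p : V) :
    pd μ (fun q => Lv q ν) p = pd μ (fun q => rv q ν) p := by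
  simp only [pd, Lv_eq, fderiv_const_add]

lemma pd_Lbv (μ ν : Fin 4) (p : V) :
    pd μ (fun q => Lbv q ν) p = -pd μ (fun q => rv q ν) p := by
  simp only [pd, Lbv_eq, fderiv_const_sub, _root_.neg_apply]

lemma pd_Pv (μ ν : Fin 4) (j : Fin 3) {p : V} (hr : 0 < rad p) :
    pd μ (fun q => Pv q j ν) p = -(pd μ (fun q => rv q j.succ) p * rv p ν
      + rv p j.succ * pd μ (fun q => rv q ν) p) := by
  rw [← pd_mul μ (differentiableAt_rv _ hr) (differentiableAt_rv _ hr)]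
  simp only [pd, Pv_eq, fderiv_const_sub, _root_.neg_apply]

/-! ### Calculus of the covariant derivative -/

lemma covD_congr (A : V → Fin 4 → ℝ) (μ : Fin 4) {f g : V → ℂ} {p : V} (h : f =ᶠ[𝓝 p] g) :
    covD A μ f p = covD A μ g p := by
  rw [covD, covD, pdC, pdC, h.fderiv_eq, h.eq_of_nhds]

lemma covD_add (A : V → Fin 4 → ℝ) (μ : Fin 4) {f g : V → ℂ} {p : V}
    (hf : DifferentiableAt ℝ f p) (hg : DifferentiableAt ℝ g p) :
    covD A μ (fun q => f q + g q) p = covD A μ f p + covD A μ g p := by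
  simp only [covD, pdC]
  rw [fderiv_fun_add hf hg, _root_.add_apply]
  ring

lemma covD_sum (A : V → Fin 4 → ℝ) (μ : Fin 4) {ι : Type*} (s : Finset ι) {f : ι → V → ℂ} {p : V}
    (hf : ∀ i ∈ s, DifferentiableAt ℝ (f i) p) :
    covD A μ (fun q => ∑ i ∈ s, f i q) p = ∑ i ∈ s, covD A μ (f i) p := by
  simp only [covD, pdC]
  rw [fderiv_fun_sum hf, _root_.sum_apply, Finset.mul_sum, Finset.sum_add_distrib]

lemma hasFDerivAt_ofReal_comp {f : V → ℝ} {p : V} (hf : DifferentiableAt ℝ f p) :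
    HasFDerivAt (fun q => (f q : ℂ)) (Complex.ofRealCLM.comp (fderiv ℝ f p)) p :=
  Complex.ofRealCLM.hasFDerivAt.comp p hf.hasFDerivAt

lemma differentiableAt_ofReal_mul {f : V → ℝ} {g : V → ℂ} {p : V} (hf : DifferentiableAt ℝ f p)
    (hg : DifferentiableAt ℝ g p) : DifferentiableAt ℝ (fun q => (f q : ℂ) * g q) p :=
  (hasFDerivAt_ofReal_comp hf).differentiableAt.mul hg

lemma covD_mul (A : V → Fin 4 → ℝ) (μ : Fin 4) {f : V → ℝ} {g : V → ℂ} {p : V}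
    (hf : DifferentiableAt ℝ f p) (hg : DifferentiableAt ℝ g p) :
    covD A μ (fun q => (f q : ℂ) * g q) p = pd μ f p * g p + f p * covD A μ g p := by
  have h : HasFDerivAt (fun q => (f q : ℂ) * g q) _ p :=
    (hasFDerivAt_ofReal_comp hf).mul hg.hasFDerivAt
  simp only [covD, pdC, pd]
  rw [h.fderiv]
  simp
  ring

lemma contDiff_covD {A : V → Fin 4 → ℝ} (hA : ContDiff ℝ (⊤ : ℕ∞) A) {φ : V → ℂ}
    (hφ : ContDiff ℝ (⊤ : ℕ∞) φ) (μ : Fin 4) : ContDiff ℝ (⊤ : ℕ∞) (covD A μ φ) := by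
  have hAμ : ContDiff ℝ (⊤ : ℕ∞) fun q => (A q μ : ℂ) :=
    Complex.ofRealCLM.contDiff.comp (contDiff_pi.1 hA μ)
  have hd : ContDiff ℝ (⊤ : ℕ∞) fun q => fderiv ℝ φ q (Pi.single μ 1) :=
    (hφ.fderiv_right (by simp)).clm_apply contDiff_const
  exact hd.add ((contDiff_const.mul hAμ).mul hφ)

lemma dirD_dirD (A : V → Fin 4 → ℝ) (X : V) (Y : V → V) {ψ : V → ℂ} {p : V}
    (hY : ∀ ν, DifferentiableAt ℝ (fun q => Y q ν) p)
    (hψ : ∀ ν, DifferentiableAt ℝ (covD A ν ψ) p) :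
    dirD A X (fun q => dirD A (Y q) ψ q) p
      = ∑ μ, (X μ : ℂ) * ∑ ν, ((pd μ (fun q => Y q ν) p : ℂ) * covD A ν ψ p
          + Y p ν * covD2 A μ ν ψ p) := by
  refine Finset.sum_congr rfl fun μ _ => ?_
  simp only [dirD]
  rw [covD_sum A μ _ fun ν _ => differentiableAt_ofReal_mul (hY ν) (hψ ν)]
  simp only [covD_mul A μ (hY _) (hψ _)]
  rfl

/-- The commutator of covariant derivatives is the curvature. -/
lemma covD2_comm {A : V → Fin 4 → ℝ} (hA : ContDiff ℝ (⊤ : ℕ∞) A) {φ : V → ℂ}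
    (hφ : ContDiff ℝ (⊤ : ℕ∞) φ) (μ ν : Fin 4) (p : V) :
    covD2 A μ ν φ p = covD2 A ν μ φ p + Complex.I * curv A p μ ν * φ p := by
  have hAd : ∀ ν, DifferentiableAt ℝ (fun q => A q ν) p := fun ν =>
    (contDiff_pi.1 hA ν).contDiffAt.differentiableAt (by simp)
  have hφd : DifferentiableAt ℝ φ p := hφ.contDiffAt.differentiableAt (by simp)
  have hdφ : DifferentiableAt ℝ (fderiv ℝ φ) p :=
    (hφ.fderiv_right (m := 1) (WithTop.coe_le_coe.2 le_top)).contDiffAt.differentiableAt (by simp)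
  have key : ∀ μ ν, pdC μ (covD A ν φ) p
      = fderiv ℝ (fderiv ℝ φ) p (Pi.single μ 1) (Pi.single ν 1)
        + Complex.I * (pd μ (fun q => A q ν) p * φ p + A p ν * pdC μ φ p) := fun μ ν => by
    have h1 := hdφ.hasFDerivAt.clm_apply (hasFDerivAt_const (Pi.single ν (1 : ℝ) : V) p)
    have h2 := ((hasFDerivAt_ofReal_comp (hAd ν)).const_mul Complex.I).mul hφd.hasFDerivAt
    have h : HasFDerivAt (covD A ν φ) _ p := h1.add h2
    rw [pdC, h.fderiv]
    simp [pd, pdC]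
    ring
  have hs : fderiv ℝ (fderiv ℝ φ) p (Pi.single μ 1) (Pi.single ν 1)
      = fderiv ℝ (fderiv ℝ φ) p (Pi.single ν 1) (Pi.single μ 1) :=
    (hφ.contDiffAt.isSymmSndFDerivAt
      (by simpa using WithTop.coe_le_coe.2 (le_top (a := (2 : ℕ∞))))) _ _
  simp only [covD2, key, hs, curv, covD]
  push_cast
  ring

lemma covD_psi (A : V → Fin 4 → ℝ) {φ : V → ℂ} (ν : Fin 4) {p : V} (hr : 0 < rad p)
    (hφ : DifferentiableAt ℝ φ p) :
    covD A ν (psi φ) p = rv p ν * φ p + rad p * covD A ν φ p := by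
  rw [← pd_rad ν hr]
  exact covD_mul A ν ((contDiffAt_rad hr (n := 1)).differentiableAt (by simp)) hφ

lemma covD_psi_eventuallyEq (A : V → Fin 4 → ℝ) {φ : V → ℂ} (hφ : Differentiable ℝ φ) (ν : Fin 4)
    {p : V} (hr : 0 < rad p) :
    covD A ν (psi φ) =ᶠ[𝓝 p] fun q => rv q ν * φ q + rad q * covD A ν φ q := by
  filter_upwards [eventually_rad_pos hr] with q hq
  exact covD_psi A ν hq (hφ q)

lemma differentiableAt_covD_psi {A : V → Fin 4 → ℝ} (hA : ContDiff ℝ (⊤ : ℕ∞) A) {φ : V → ℂ}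
    (hφ : ContDiff ℝ (⊤ : ℕ∞) φ) (ν : Fin 4) {p : V} (hr : 0 < rad p) :
    DifferentiableAt ℝ (covD A ν (psi φ)) p := by
  have hφd : Differentiable ℝ φ := hφ.differentiable (by simp)
  have hcd : Differentiable ℝ (covD A ν φ) := (contDiff_covD hA hφ ν).differentiable (by simp)
  have hrd : DifferentiableAt ℝ rad p := (contDiffAt_rad hr (n := 1)).differentiableAt (by simp)
  refine DifferentiableAt.congr_of_eventuallyEq ?_ (covD_psi_eventuallyEq A hφd ν hr)
  exact (differentiableAt_ofReal_mul (differentiableAt_rv ν hr) (hφd p)).add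
    (differentiableAt_ofReal_mul hrd (hcd p))

lemma covD2_psi {A : V → Fin 4 → ℝ} (hA : ContDiff ℝ (⊤ : ℕ∞) A) {φ : V → ℂ}
    (hφ : ContDiff ℝ (⊤ : ℕ∞) φ) (μ ν : Fin 4) {p : V} (hr : 0 < rad p) :
    covD2 A μ ν (psi φ) p = pd μ (fun q => rv q ν) p * φ p + rv p ν * covD A μ φ p
      + rv p μ * covD A ν φ p + rad p * covD2 A μ ν φ p := by
  have hφd : Differentiable ℝ φ := hφ.differentiable (by simp)
  have hcd : Differentiable ℝ (covD A ν φ) := (contDiff_covD hA hφ ν).differentiable (by simp)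
  have hrd : DifferentiableAt ℝ rad p := (contDiffAt_rad hr (n := 1)).differentiableAt (by simp)
  have hvd := differentiableAt_rv ν hr
  change covD A μ (covD A ν (psi φ)) p = _
  rw [covD_congr A μ (covD_psi_eventuallyEq A hφd ν hr),
    covD_add A μ (differentiableAt_ofReal_mul hvd (hφd p))
      (differentiableAt_ofReal_mul hrd (hcd p)),
    covD_mul A μ hvd (hφd p), covD_mul A μ hrd (hcd p), pd_rad μ hr]
  change _ = _ + (rad p : ℂ) * covD A μ (covD A ν φ) p
  ring

/-! ### Contractions with the null frame and the spheres -/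

lemma rhoC_curv (A : V → Fin 4 → ℝ) (p : V) :
    rhoC (curv A) p
      = rv p 1 * curv A p 0 1 + rv p 2 * curv A p 0 2 + rv p 3 * curv A p 0 3 := by
  simp only [rhoC, ap2, Fin.sum_univ_four, Lv_eq, Lbv_eq, rv_zero, curv]
  simp
  ring

lemma boxA_psi {A : V → Fin 4 → ℝ} (hA : ContDiff ℝ (⊤ : ℕ∞) A) {φ : V → ℂ}
    (hφ : ContDiff ℝ (⊤ : ℕ∞) φ) {p : V} (hr : 0 < rad p) :
    boxA A (psi φ) p = rad p * boxA A φ p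
      + 2 * (rad p : ℂ)⁻¹ * (rv p 1 * covD A 1 (psi φ) p + rv p 2 * covD A 2 (psi φ) p
          + rv p 3 * covD A 3 (psi φ) p) := by
  have hn : (rv p 1 : ℂ) ^ 2 + (rv p 2 : ℂ) ^ 2 + (rv p 3 : ℂ) ^ 2 = 1 := by
    exact_mod_cast sum_rv_sq hr
  have hs : (rad p : ℂ) * (rad p : ℂ)⁻¹ = 1 := mul_inv_cancel₀ (by exact_mod_cast hr.ne')
  simp only [boxA, Fin.sum_univ_four, covD2_psi hA hφ _ _ hr, pd_rv _ _ hr, rv_zero,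
    covD_psi A _ hr (hφ.contDiffAt.differentiableAt (by simp)), eta]
  simp
  linear_combination (-3 * (rad p : ℂ)⁻¹ * φ p) * hn
    - 2 * (rv p 1 * covD A 1 φ p + rv p 2 * covD A 2 φ p + rv p 3 * covD A 3 φ p) * hs

lemma covLapSph_eq {A : V → Fin 4 → ℝ} {ψ : V → ℂ} {p : V} (hr : 0 < rad p)
    (hψ : ∀ ν, DifferentiableAt ℝ (covD A ν ψ) p) :
    covLapSph A ψ p = covD2 A 1 1 ψ p + covD2 A 2 2 ψ p + covD2 A 3 3 ψ p
      - (∑ μ, ∑ ν, (rv p μ : ℂ) * rv p ν * covD2 A μ ν ψ p)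
      - 2 * (rad p : ℂ)⁻¹ * (rv p 1 * covD A 1 ψ p + rv p 2 * covD A 2 ψ p
          + rv p 3 * covD A 3 ψ p) := by
  have hn : (rv p 1 : ℂ) ^ 2 + (rv p 2 : ℂ) ^ 2 + (rv p 3 : ℂ) ^ 2 = 1 := by
    exact_mod_cast sum_rv_sq hr
  have hP : ∀ j ν, DifferentiableAt ℝ (fun q => Pv q j ν) p := fun j ν => by
    simp only [Pv_eq]
    exact ((differentiableAt_rv _ hr).mul (differentiableAt_rv _ hr)).const_sub _
  simp only [covLapSph, dirD_dirD A _ (fun q => Pv q _) (hP _) hψ, pd_Pv _ _ _ hr, pd_rv _ _ hr]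
  have e1 : Fin.succ (0 : Fin 3) = 1 := rfl
  have e2 : Fin.succ (1 : Fin 3) = 2 := rfl
  have e3 : Fin.succ (2 : Fin 3) = 3 := rfl
  simp only [Pv_eq, Fin.sum_univ_three, Fin.sum_univ_four, e1, e2, e3, rv_zero]
  simp
  linear_combination (norm := skip) ((∑ μ, ∑ ν, (rv p μ : ℂ) * rv p ν * covD2 A μ ν ψ p)
    - 2 * (rad p : ℂ)⁻¹ * ((rv p 1 : ℂ) ^ 2 + (rv p 2 : ℂ) ^ 2 + (rv p 3 : ℂ) ^ 2 - 1)
      * (rv p 1 * covD A 1 ψ p + rv p 2 * covD A 2 ψ p + rv p 3 * covD A 3 ψ p)) * hn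
  simp only [Fin.sum_univ_four, rv_zero, Complex.ofReal_zero]
  ring

lemma dirD_Lv_Lbv {A : V → Fin 4 → ℝ} {ψ : V → ℂ} {p : V} (hr : 0 < rad p)
    (hψ : ∀ ν, DifferentiableAt ℝ (covD A ν ψ) p) :
    dirD A (Lv p) (fun q => dirD A (Lbv q) ψ q) p = covD2 A 0 0 ψ p
      - (∑ μ, ∑ ν, (rv p μ : ℂ) * rv p ν * covD2 A μ ν ψ p)
      - ∑ μ, (rv p μ : ℂ) * (covD2 A 0 μ ψ p - covD2 A μ 0 ψ p) := by
  have hn : (rv p 1 : ℂ) ^ 2 + (rv p 2 : ℂ) ^ 2 + (rv p 3 : ℂ) ^ 2 = 1 := by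
    exact_mod_cast sum_rv_sq hr
  have hL : ∀ ν, DifferentiableAt ℝ (fun q => Lbv q ν) p := fun ν => by
    simp only [Lbv_eq]
    exact (differentiableAt_rv _ hr).const_sub _
  rw [dirD_dirD A _ Lbv hL hψ]
  simp only [pd_Lbv, pd_rv _ _ hr]
  simp only [Lv_eq, Lbv_eq, Fin.sum_univ_four, rv_zero]
  simp
  linear_combination ((rad p : ℂ)⁻¹
      * (rv p 1 * covD A 1 ψ p + rv p 2 * covD A 2 ψ p + rv p 3 * covD A 3 ψ p)) * hn

lemma dirD_Lbv_Lv {A : V → Fin 4 → ℝ} {ψ : V → ℂ} {p : V} (hr : 0 < rad p)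
    (hψ : ∀ ν, DifferentiableAt ℝ (covD A ν ψ) p) :
    dirD A (Lbv p) (fun q => dirD A (Lv q) ψ q) p = covD2 A 0 0 ψ p
      - (∑ μ, ∑ ν, (rv p μ : ℂ) * rv p ν * covD2 A μ ν ψ p)
      + ∑ μ, (rv p μ : ℂ) * (covD2 A 0 μ ψ p - covD2 A μ 0 ψ p) := by
  have hn : (rv p 1 : ℂ) ^ 2 + (rv p 2 : ℂ) ^ 2 + (rv p 3 : ℂ) ^ 2 = 1 := by
    exact_mod_cast sum_rv_sq hr
  have hL : ∀ ν, DifferentiableAt ℝ (fun q => Lv q ν) p := fun ν => by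
    simp only [Lv_eq]
    exact (differentiableAt_rv _ hr).const_add _
  rw [dirD_dirD A _ Lv hL hψ]
  simp only [pd_Lv, pd_rv _ _ hr]
  simp only [Lv_eq, Lbv_eq, Fin.sum_univ_four, rv_zero]
  simp
  linear_combination ((rad p : ℂ)⁻¹
      * (rv p 1 * covD A 1 ψ p + rv p 2 * covD A 2 ψ p + rv p 3 * covD A 3 ψ p)) * hn

/-- The commutator of the time and radial covariant derivatives on `rφ`. -/
lemma sum_rv_mul_comm_psi {A : V → Fin 4 → ℝ} (hA : ContDiff ℝ (⊤ : ℕ∞) A) {φ : V → ℂ}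
    (hφ : ContDiff ℝ (⊤ : ℕ∞) φ) {p : V} (hr : 0 < rad p) :
    ∑ μ, (rv p μ : ℂ) * (covD2 A 0 μ (psi φ) p - covD2 A μ 0 (psi φ) p)
      = Complex.I * rhoC (curv A) p * psi φ p := by
  simp only [Fin.sum_univ_four, covD2_psi hA hφ _ _ hr, pd_rv _ _ hr, psi,
    covD2_comm hA hφ 0 1 p, covD2_comm hA hφ 0 2 p, covD2_comm hA hφ 0 3 p]
  simp only [rv_zero, rhoC_curv]
  simp
  ring

end MKG

open MKG in
/-- Under the null frame the covariant wave operator factorizes: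
r·□_Aφ = −D_L D_{L̲}(rφ) + D̸²(rφ) − iρ·(rφ) = −D_{L̲} D_L(rφ) + D̸²(rφ) + iρ·(rφ),
where ρ = ½ F(L̲,L), F = dA. -/
theorem statement17 (A : V → Fin 4 → ℝ) (hA : ContDiff ℝ (⊤ : ℕ∞) A)
    (φ : V → ℂ) (hφ : ContDiff ℝ (⊤ : ℕ∞) φ) (p : V) (hr : 0 < rad p) :
    ((rad p : ℂ) * boxA A φ p
        = -dirD A (Lv p) (fun q => dirD A (Lbv q) (psi φ) q) p
            + covLapSph A (psi φ) p - Complex.I * (rhoC (curv A) p : ℂ) * psi φ p)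
    ∧ ((rad p : ℂ) * boxA A φ p
        = -dirD A (Lbv p) (fun q => dirD A (Lv q) (psi φ) q) p
            + covLapSph A (psi φ) p + Complex.I * (rhoC (curv A) p : ℂ) * psi φ p) := by
  have hψ : ∀ ν, DifferentiableAt ℝ (covD A ν (psi φ)) p := fun ν =>
    differentiableAt_covD_psi hA hφ ν hr
  have hbox := boxA_psi hA hφ hr
  have hlap := covLapSph_eq hr hψ
  have hcomm := sum_rv_mul_comm_psi hA hφ hr
  have hpsi : boxA A (psi φ) p = -covD2 A 0 0 (psi φ) p + covD2 A 1 1 (psi φ) p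
      + covD2 A 2 2 (psi φ) p + covD2 A 3 3 (psi φ) p := by
    simp [boxA, eta, Fin.sum_univ_four]
  rw [dirD_Lv_Lbv hr hψ, dirD_Lbv_Lv hr hψ, hcomm]
  constructor <;> linear_combination hpsi - hbox - hlap
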